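/- Let r, s ∈ ℂ and set a = r + sτ; assume 2a ∉ Λ_τ and suppose ζ(a) = r η₁ + s η₂. Define h(z) = e^{2ζ(a)z} σ(z−a) / σ(z+a). Then, as meromorphic functions, h(z+1) = e^{−4πi s} h(z) and h(z+τ) = e^{4πi r} h(z); that is, h is a type II developing map with monodromy data (r, s). Consequently f := h² satisfies the type II condition with monodromy data (2r, 2s). -/

import Mathlib

open Complex Filter Topology

noncomputable section

/-- The lattice `Λ_τ = ℤ + τℤ`. -/
def Lam (τ : ℂ) : Set ℂ := {ω | ∃ m n : ℤ, ω = (m : ℂ) + (n : ℂ) * τ}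

/-- The nonzero lattice points. -/
def Lam' (τ : ℂ) : Set ℂ := {ω | ω ∈ Lam τ ∧ ω ≠ 0}

/-- The Weierstrass elliptic function `℘(z; τ)`. -/
def wp (τ z : ℂ) : ℂ :=
  1 / z ^ 2 + ∑' ω : Lam' τ, (1 / (z - (ω : ℂ)) ^ 2 - 1 / (ω : ℂ) ^ 2)

/-- The Weierstrass zeta function `ζ(z; τ)`. -/
def wzeta (τ z : ℂ) : ℂ :=
  1 / z + ∑' ω : Lam' τ, (1 / (z - (ω : ℂ)) + 1 / (ω : ℂ) + z / (ω : ℂ) ^ 2)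

/-- The Weierstrass sigma function `σ(z; τ)`. -/
def wsigma (τ z : ℂ) : ℂ :=
  z * ∏' ω : Lam' τ,
    ((1 - z / (ω : ℂ)) * Complex.exp (z / (ω : ℂ) + z ^ 2 / (2 * (ω : ℂ) ^ 2)))

/-- `℘'(z; τ)`. -/
def wpd (τ : ℂ) : ℂ → ℂ := deriv (wp τ)

/-- `℘''(z; τ)`. -/
def wpdd (τ : ℂ) : ℂ → ℂ := deriv (deriv (wp τ))

/-- The constant `B(A)`. -/
def Bc (τ p A : ℂ) : ℂ :=
  A ^ 2 - wzeta τ (2 * p) * A - 3 / 4 * wp τ (2 * p) - 2 * wp τ p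

/-- The potential `q(z; A)`. -/
def qpot (τ p A z : ℂ) : ℂ :=
  2 * wp τ z + 3 / 4 * (wp τ (z + p) + wp τ (z - p))
    + A * (wzeta τ (z + p) - wzeta τ (z - p)) + Bc τ p A

/-- The singular set `S = Λ_τ ∪ (p + Λ_τ) ∪ (−p + Λ_τ)`. -/
def Sset (τ p : ℂ) : Set ℂ :=
  Lam τ ∪ {z | z - p ∈ Lam τ} ∪ {z | z + p ∈ Lam τ}

/-- The unique elliptic solution `Φ_e(z; A)` of the second symmetric product equation. -/
def Phie (τ p A z : ℂ) : ℂ :=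
  wp τ z + (A / 2 - 3 * wpdd τ p / (8 * wpd τ p)) * (wzeta τ (z + p) - wzeta τ (z - p))
    - A ^ 2 + (wpdd τ p / (2 * wpd τ p) - wzeta τ p) * A
    - wp τ p + 3 / 4 * (wpdd τ p / wpd τ p) * wzeta τ p
    + 3 / 16 * (wpdd τ p ^ 2 / wpd τ p ^ 2)

/-- The cubic factor `Y₁(A)`. -/
def Y1 (τ p A : ℂ) : ℂ :=
  A ^ 3 - 5 * wpdd τ p / (4 * wpd τ p) * A ^ 2
    + 3 * (wp τ p + wpdd τ p ^ 2 / (16 * wpd τ p ^ 2)) * A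
    + wpd τ p / 2 - 9 * wpdd τ p / (4 * wpd τ p) * wp τ p
    + 9 / 64 * (wpdd τ p ^ 3 / wpd τ p ^ 3)

/-- The cubic factor `Y₂(A)`. -/
def Y2 (τ p A : ℂ) : ℂ :=
  A ^ 3 - wpdd τ p / (4 * wpd τ p) * A ^ 2
    - 5 / 16 * (wpdd τ p ^ 2 / wpd τ p ^ 2) * A
    + 2 * wpd τ p - 3 / 64 * (wpdd τ p ^ 3 / wpd τ p ^ 3)

/-- The quasi-period `η₁ = 2ζ(1/2)`. -/
def eta1 (τ : ℂ) : ℂ := 2 * wzeta τ (1 / 2)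

/-- The quasi-period `η₂ = 2ζ(τ/2)`. -/
def eta2 (τ : ℂ) : ℂ := 2 * wzeta τ (τ / 2)

/-- The type II developing map `h(z) = e^{2ζ(a)z} σ(z−a)/σ(z+a)`. -/
def hdev (τ a z : ℂ) : ℂ :=
  Complex.exp (2 * wzeta τ a * z) * wsigma τ (z - a) / wsigma τ (z + a)


/-! ### Lattice points -/

/-- The lattice point `m + nτ` attached to the pair `(m, n)`. -/
def latPt (τ : ℂ) (p : ℤ × ℤ) : ℂ := p.1 + p.2 * τ

lemma latPt_mem (τ : ℂ) (p : ℤ × ℤ) : latPt τ p ∈ Lam τ := ⟨p.1, p.2, rfl⟩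

lemma neg_mem_Lam {τ x : ℂ} (hx : x ∈ Lam τ) : -x ∈ Lam τ := by
  obtain ⟨m, n, rfl⟩ := hx
  exact ⟨-m, -n, by push_cast; ring⟩

lemma add_mem_Lam {τ x y : ℂ} (hx : x ∈ Lam τ) (hy : y ∈ Lam τ) : x + y ∈ Lam τ := by
  obtain ⟨m, n, rfl⟩ := hx
  obtain ⟨m', n', rfl⟩ := hy
  exact ⟨m + m', n + n', by push_cast; ring⟩

lemma add_mem_Lam_iff {τ x y : ℂ} (hy : y ∈ Lam τ) : x + y ∈ Lam τ ↔ x ∈ Lam τ :=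
  ⟨fun h ↦ by simpa using add_mem_Lam h (neg_mem_Lam hy), fun h ↦ add_mem_Lam h hy⟩

lemma zero_mem_Lam (τ : ℂ) : (0 : ℂ) ∈ Lam τ := ⟨0, 0, by simp⟩

lemma one_mem_Lam (τ : ℂ) : (1 : ℂ) ∈ Lam τ := ⟨1, 0, by simp⟩

lemma tau_mem_Lam (τ : ℂ) : τ ∈ Lam τ := ⟨0, 1, by simp⟩

lemma latPt_injective {τ : ℂ} (hτ : 0 < τ.im) : Function.Injective (latPt τ) := by
  rintro ⟨m, n⟩ ⟨m', n'⟩ h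
  have him : n = n' := by simpa [latPt, hτ.ne'] using congrArg Complex.im h
  subst him
  simpa [latPt] using h

lemma latPt_eq_zero_iff {τ : ℂ} (hτ : 0 < τ.im) {p : ℤ × ℤ} : latPt τ p = 0 ↔ p = 0 := by
  rw [← (latPt_injective hτ).eq_iff (a := p), show latPt τ 0 = 0 by simp [latPt]]

lemma half_notMem_Lam {τ : ℂ} (hτ : 0 < τ.im) : (1 / 2 : ℂ) ∉ Lam τ := by
  rintro ⟨m, n, h⟩
  have hn : n = 0 := by simpa [hτ.ne'] using congrArg Complex.im h
  subst hn
  have h2 : ((1 : ℤ) : ℂ) = ((2 * m : ℤ) : ℂ) := by push_cast; linear_combination 2 * h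
  have := Int.cast_injective h2
  omega

lemma half_tau_notMem_Lam {τ : ℂ} (hτ : 0 < τ.im) : τ / 2 ∉ Lam τ := by
  rintro ⟨m, n, h⟩
  have him : τ.im / 2 = n * τ.im := by simpa using congrArg Complex.im h
  have h2 : ((1 : ℤ) : ℝ) = ((2 * n : ℤ) : ℝ) := by
    push_cast
    apply mul_right_cancel₀ hτ.ne'
    linear_combination 2 * him
  have := Int.cast_injective h2
  omega

/-- The period pair `(1, τ)`. -/
def unitPeriodPair (τ : ℂ) (hτ : 0 < τ.im) : PeriodPair where
  ω₁ := 1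
  ω₂ := τ
  indep := by
    rw [LinearIndependent.pair_iff]
    intro s t h
    have ht : t = 0 := by simpa [hτ.ne'] using congrArg Complex.im h
    subst ht
    simpa using h

lemma summable_norm_latPt {τ : ℂ} (hτ : 0 < τ.im) :
    Summable fun p ↦ ‖latPt τ p‖ ^ (-3 : ℤ) := by
  let L := unitPeriodPair τ hτ
  have h : Summable fun l : L.lattice ↦ ‖l‖ ^ (-3 : ℤ) :=
    ZLattice.summable_norm_zpow _ _ (by simp)
  refine (h.comp_injective L.latticeEquivProd.symm.injective).congr fun p ↦ ?_
  change ‖(L.latticeEquivProd.symm p : ℂ)‖ ^ (-3 : ℤ) = _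
  rw [L.latticeEquiv_symm_apply p]
  simp [L, unitPeriodPair, latPt]

lemma coe_lattice_unitPeriodPair {τ : ℂ} (hτ : 0 < τ.im) :
    ((unitPeriodPair τ hτ).lattice : Set ℂ) = Lam τ := by
  ext x
  simp [PeriodPair.mem_lattice, Lam, unitPeriodPair, eq_comm]

lemma isClosed_Lam {τ : ℂ} (hτ : 0 < τ.im) : IsClosed (Lam τ) :=
  coe_lattice_unitPeriodPair hτ ▸ (unitPeriodPair τ hτ).isClosed_lattice

lemma Lam_eq_range (τ : ℂ) : Lam τ = Set.range (latPt τ) := by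
  ext x
  simp [Lam, latPt, eq_comm]

lemma isPreconnected_compl_Lam (τ : ℂ) : IsPreconnected (Lam τ)ᶜ := by
  refine (Set.Countable.isConnected_compl_of_one_lt_rank (by simp) ?_).2
  rw [Lam_eq_range]
  exact Set.countable_range _

lemma eventually_le_norm_latPt {τ : ℂ} (hτ : 0 < τ.im) (R : ℝ) :
    ∀ᶠ p in cofinite, R ≤ ‖latPt τ p‖ := by
  wlog hR : 0 < R
  · filter_upwards [this hτ 1 one_pos] with p hp using by linarith
  have h0 : ∀ᶠ p : ℤ × ℤ in cofinite, p ≠ 0 := (Set.finite_singleton 0).compl_mem_cofinite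
  filter_upwards [(summable_norm_latPt hτ).tendsto_cofinite_zero.eventually_lt_const
    (u := R ^ (-3 : ℤ)) (by positivity), h0] with p hp hp0
  have hpos : 0 < ‖latPt τ p‖ := norm_pos_iff.mpr ((latPt_eq_zero_iff hτ).not.mpr hp0)
  by_contra! hlt
  refine hp.not_ge ?_
  simp only [zpow_neg]
  gcongr
  exact pow_le_pow_left₀ (norm_nonneg _) hlt.le 3

/-- The nonzero lattice points are indexed by the nonzero pairs of integers. -/
def nonzeroLatEquiv (τ : ℂ) (hτ : 0 < τ.im) : {p : ℤ × ℤ // p ∉ ({0} : Finset (ℤ × ℤ))} ≃ Lam' τ :=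
  Equiv.ofBijective
    (fun p ↦ ⟨latPt τ p, latPt_mem τ p, (latPt_eq_zero_iff hτ).not.mpr (by simpa using p.2)⟩)
    ⟨fun p q h ↦ Subtype.ext (latPt_injective hτ (congrArg Subtype.val h)), by
      rintro ⟨x, ⟨m, n, rfl⟩, hx⟩
      exact ⟨⟨(m, n), by simpa [← latPt_eq_zero_iff hτ, latPt] using hx⟩, rfl⟩⟩

lemma summable_norm_Lam' {τ : ℂ} (hτ : 0 < τ.im) :
    Summable fun ω : Lam' τ ↦ ‖(ω : ℂ)‖ ^ (-3 : ℤ) :=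
  (nonzeroLatEquiv τ hτ).summable_iff.mp ((summable_norm_latPt hτ).subtype _)

lemma eventually_le_norm_Lam' {τ : ℂ} (hτ : 0 < τ.im) (R : ℝ) :
    ∀ᶠ ω : Lam' τ in cofinite, R ≤ ‖(ω : ℂ)‖ := by
  have h := (Subtype.val_injective.comp (nonzeroLatEquiv τ hτ).symm.injective).tendsto_cofinite
  filter_upwards [h.eventually (eventually_le_norm_latPt hτ R)] with ω hω
  obtain ⟨p, rfl⟩ := (nonzeroLatEquiv τ hτ).surjective ω
  change R ≤ ‖latPt τ p‖
  simpa using hω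

/-! ### The zeta function as a sum over the whole lattice -/

/-- The summand of the Weierstrass zeta function; division by zero makes it `1 / z` at `ω = 0`. -/
def zetaTerm (ω z : ℂ) : ℂ := 1 / (z - ω) + 1 / ω + z / ω ^ 2

lemma norm_zetaTerm_le {ω z : ℂ} (hω : ω ≠ 0) (h : 2 * ‖z‖ ≤ ‖ω‖) :
    ‖zetaTerm ω z‖ ≤ 2 * ‖z‖ ^ 2 * ‖ω‖ ^ (-3 : ℤ) := by
  have hpos : 0 < ‖ω‖ := norm_pos_iff.mpr hω
  have hsub : ‖ω‖ / 2 ≤ ‖z - ω‖ := by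
    rw [norm_sub_rev]
    exact .trans (by linarith) (norm_sub_norm_le ω z)
  have hne : z - ω ≠ 0 := norm_pos_iff.mp (by linarith)
  have : zetaTerm ω z = z ^ 2 / (ω ^ 2 * (z - ω)) := by
    rw [zetaTerm]
    field_simp
    ring
  rw [this, norm_div, norm_mul, norm_pow, norm_pow]
  calc ‖z‖ ^ 2 / (‖ω‖ ^ 2 * ‖z - ω‖) ≤ ‖z‖ ^ 2 / (‖ω‖ ^ 2 * (‖ω‖ / 2)) := by gcongr
    _ = 2 * ‖z‖ ^ 2 * ‖ω‖ ^ (-3 : ℤ) := by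
      rw [zpow_neg]
      norm_cast
      field_simp

lemma summable_zetaTerm {τ : ℂ} (hτ : 0 < τ.im) (z : ℂ) :
    Summable fun p ↦ zetaTerm (latPt τ p) z := by
  refine .of_norm_bounded_eventually ((summable_norm_latPt hτ).mul_left (2 * ‖z‖ ^ 2)) ?_
  have h0 : ∀ᶠ p : ℤ × ℤ in cofinite, p ≠ 0 := (Set.finite_singleton 0).compl_mem_cofinite
  filter_upwards [eventually_le_norm_latPt hτ (2 * ‖z‖), h0] with p hp hp0
  exact norm_zetaTerm_le ((latPt_eq_zero_iff hτ).not.mpr hp0) hp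

lemma summable_zetaTerm_Lam' {τ : ℂ} (hτ : 0 < τ.im) (z : ℂ) :
    Summable fun ω : Lam' τ ↦ zetaTerm ω z :=
  (nonzeroLatEquiv τ hτ).summable_iff.mp ((summable_zetaTerm hτ z).subtype _)

lemma wzeta_eq_tsum {τ : ℂ} (hτ : 0 < τ.im) (z : ℂ) :
    wzeta τ z = ∑' p, zetaTerm (latPt τ p) z := by
  rw [← (summable_zetaTerm hτ z).sum_add_tsum_subtype_compl {0}, Finset.sum_singleton, wzeta,
    ← (nonzeroLatEquiv τ hτ).tsum_eq]
  congr 1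
  simp [zetaTerm, latPt]

/-- Negation on the nonzero lattice points. -/
def negLam' (τ : ℂ) : Lam' τ ≃ Lam' τ where
  toFun ω := ⟨-ω, neg_mem_Lam ω.2.1, neg_ne_zero.mpr ω.2.2⟩
  invFun ω := ⟨-ω, neg_mem_Lam ω.2.1, neg_ne_zero.mpr ω.2.2⟩
  left_inv ω := by simp
  right_inv ω := by simp

lemma wzeta_neg (τ z : ℂ) : wzeta τ (-z) = -wzeta τ z := by
  rw [wzeta, wzeta, ← (negLam' τ).tsum_eq, neg_add, ← tsum_neg]
  congr 1
  · rw [div_neg]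
  · refine tsum_congr fun ω ↦ ?_
    simp only [negLam', Equiv.coe_fn_mk, even_two.neg_pow]
    rw [show -z - -(ω : ℂ) = -(z - ω) by ring]
    simp only [div_neg, neg_div]
    ring

lemma wsigma_neg (τ z : ℂ) : wsigma τ (-z) = -wsigma τ z := by
  rw [wsigma, wsigma, ← (negLam' τ).tprod_eq, neg_mul]
  simp [negLam']

/-! ### The cotangent function as a sum over `ℤ` -/

lemma tendsto_sum_Icc_cot {u : ℂ} (hu : u ∈ Complex.integerComplement) :
    Tendsto (fun N : ℕ ↦ ∑ m ∈ Finset.Icc (-N : ℤ) N, 1 / (u - m)) atTop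
      (𝓝 (Real.pi * Complex.cot (Real.pi * u))) := by
  have h := (tendsto_logDeriv_euler_cot_sub hu).const_add (1 / u)
  rw [add_sub_cancel] at h
  refine h.congr fun N ↦ ?_
  induction N with
  | zero => simp
  | succ N ih =>
    rw [Finset.sum_range_succ, ← add_assoc, ih]
    have hI : Finset.Icc (-(N + 1 : ℕ) : ℤ) (N + 1 : ℕ) =
        insert (-(N + 1 : ℕ) : ℤ) (insert ((N + 1 : ℕ) : ℤ) (Finset.Icc (-N : ℤ) N)) := by
      ext m
      simp only [Finset.mem_Icc, Finset.mem_insert]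
      omega
    rw [hI, Finset.sum_insert (by simp; omega), Finset.sum_insert (by simp), cotTerm]
    push_cast
    ring

lemma tsum_eq_of_tendsto_sum_Icc {f : ℤ → ℂ} (hf : Summable f) {a : ℂ}
    (h : Tendsto (fun N : ℕ ↦ ∑ m ∈ Finset.Icc (-N : ℤ) N, f m) atTop (𝓝 a)) :
    ∑' m, f m = a :=
  tendsto_nhds_unique (hf.hasSum.comp Finset.tendsto_Icc_neg) h

lemma tsum_int_sub_of_tendsto {f : ℤ → ℂ} (hf : Summable fun n ↦ f n - f (n + 1)) {a b : ℂ}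
    (ha : Tendsto f atBot (𝓝 a)) (hb : Tendsto f atTop (𝓝 b)) :
    ∑' n, (f n - f (n + 1)) = a - b := by
  have h1 := (ha.comp (tendsto_neg_atTop_atBot.comp tendsto_natCast_atTop_atTop)).sub
    (hb.comp (tendsto_natCast_atTop_atTop (R := ℤ)))
  refine tendsto_nhds_unique (hf.hasSum.comp Finset.tendsto_Ico_neg) (h1.congr fun N ↦ ?_)
  simp only [Function.comp_apply]
  induction N with
  | zero => simp
  | succ N ih =>
    have hI : Finset.Ico (-(N + 1 : ℕ) : ℤ) (N + 1 : ℕ) =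
        insert (-(N + 1 : ℕ) : ℤ) (insert (N : ℤ) (Finset.Ico (-N : ℤ) N)) := by
      ext m
      simp only [Finset.mem_Ico, Finset.mem_insert]
      omega
    rw [hI, Finset.sum_insert (by simp), Finset.sum_insert (by simp), ← ih]
    push_cast
    rw [show -((N : ℤ) + 1) + 1 = -N by ring]
    ring

lemma tendsto_pi_mul_cot_of_im_atTop {α : Type*} {l : Filter α} {u : α → ℂ}
    (hu : Tendsto (fun x ↦ (u x).im) l atTop) :
    Tendsto (fun x ↦ Real.pi * Complex.cot (Real.pi * u x)) l (𝓝 (-(Real.pi * I))) := by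
  have he : Tendsto (fun x ↦ Complex.exp (2 * Real.pi * I * u x)) l (𝓝 0) := by
    rw [Complex.tendsto_exp_nhds_zero_iff]
    have : (fun x ↦ (2 * Real.pi * I * u x).re) = fun x ↦ -(2 * Real.pi * (u x).im) := by
      ext x
      simp
    rw [this]
    exact tendsto_neg_atTop_atBot.comp (hu.const_mul_atTop (by positivity))
  simp_rw [Complex.cot_pi_eq_exp_ratio]
  have := ((he.add_const 1).div ((he.const_sub 1).const_mul I) (by simp)).const_mul
    (Real.pi : ℂ)
  rw [zero_add, sub_zero, mul_one, one_div, Complex.inv_I, mul_neg] at this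
  exact this

lemma tendsto_pi_mul_cot_of_im_atBot {α : Type*} {l : Filter α} {u : α → ℂ}
    (hu : Tendsto (fun x ↦ (u x).im) l atBot) :
    Tendsto (fun x ↦ Real.pi * Complex.cot (Real.pi * u x)) l (𝓝 (Real.pi * I)) := by
  have hneg : Tendsto (fun x ↦ (-u x).im) l atTop := tendsto_neg_atBot_atTop.comp hu
  have h := (tendsto_pi_mul_cot_of_im_atTop hneg).neg
  simpa [Complex.cot_eq_cos_div_sin, div_neg] using h

lemma cot_pi_mul_add_one (u : ℂ) :
    Complex.cot (Real.pi * (u + 1)) = Complex.cot (Real.pi * u) := by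
  simp [Complex.cot_eq_cos_div_sin, mul_add, Complex.cos_add_pi, Complex.sin_add_pi]

/-! ### Quasi-periodicity of the zeta function -/

lemma sub_mul_mem_integerComplement {τ z : ℂ} (hz : z ∉ Lam τ) (n : ℤ) :
    z - n * τ ∈ Complex.integerComplement := by
  rintro ⟨m, hm⟩
  exact hz ⟨m, n, by linear_combination -hm⟩

lemma tsum_int_prod_comm {F : ℤ × ℤ → ℂ} (hF : Summable F) :
    ∑' p, F p = ∑' n, ∑' m, F (m, n) := by
  rw [← (Equiv.prodComm ℤ ℤ).tsum_eq]
  exact ((Equiv.prodComm ℤ ℤ).summable_iff.mpr hF).tsum_prod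

lemma summable_fst_section {F : ℤ × ℤ → ℂ} (hF : Summable F) (n : ℤ) :
    Summable fun m ↦ F (m, n) :=
  hF.comp_injective fun _ _ h ↦ congrArg Prod.fst h

lemma tendsto_sum_Icc_latPt {τ z : ℂ} (hz : z ∉ Lam τ) (n : ℤ) :
    Tendsto (fun N : ℕ ↦ ∑ m ∈ Finset.Icc (-N : ℤ) N, 1 / (z - latPt τ (m, n))) atTop
      (𝓝 (Real.pi * Complex.cot (Real.pi * (z - n * τ)))) := by
  refine (tendsto_sum_Icc_cot (sub_mul_mem_integerComplement hz n)).congr fun N ↦ ?_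
  refine Finset.sum_congr rfl fun m _ ↦ ?_
  rw [latPt]
  ring_nf

lemma wzeta_add_one_sub_eq {τ z z' : ℂ} (hτ : 0 < τ.im) (hz : z ∉ Lam τ) (hz' : z' ∉ Lam τ) :
    wzeta τ (z + 1) - wzeta τ z = wzeta τ (z' + 1) - wzeta τ z' := by
  have hS := ((summable_zetaTerm hτ (z + 1)).sub (summable_zetaTerm hτ z)).sub
    ((summable_zetaTerm hτ (z' + 1)).sub (summable_zetaTerm hτ z'))
  have hz1 := (add_mem_Lam_iff (one_mem_Lam τ)).not.mpr hz
  have hz1' := (add_mem_Lam_iff (one_mem_Lam τ)).not.mpr hz'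
  rw [← sub_eq_zero]
  simp only [wzeta_eq_tsum hτ]
  rw [← (summable_zetaTerm hτ (z + 1)).tsum_sub (summable_zetaTerm hτ z),
    ← (summable_zetaTerm hτ (z' + 1)).tsum_sub (summable_zetaTerm hτ z'),
    ← ((summable_zetaTerm hτ (z + 1)).sub (summable_zetaTerm hτ z)).tsum_sub
      ((summable_zetaTerm hτ (z' + 1)).sub (summable_zetaTerm hτ z')), tsum_int_prod_comm hS]
  refine (tsum_congr fun n ↦ ?_).trans tsum_zero
  refine tsum_eq_of_tendsto_sum_Icc (summable_fst_section hS n) ?_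
  have h := ((tendsto_sum_Icc_latPt hz1 n).sub (tendsto_sum_Icc_latPt hz n)).sub
    ((tendsto_sum_Icc_latPt hz1' n).sub (tendsto_sum_Icc_latPt hz' n))
  rw [add_sub_right_comm z, add_sub_right_comm z', cot_pi_mul_add_one, cot_pi_mul_add_one,
    sub_self, sub_self, sub_self] at h
  refine h.congr fun N ↦ ?_
  simp only [← Finset.sum_sub_distrib]
  refine Finset.sum_congr rfl fun m _ ↦ ?_
  simp only [zetaTerm]
  ring

lemma wzeta_add_one {τ z : ℂ} (hτ : 0 < τ.im) (hz : z ∉ Lam τ) :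
    wzeta τ (z + 1) = wzeta τ z + eta1 τ := by
  have hh : (-(1 / 2) : ℂ) ∉ Lam τ := fun h ↦ half_notMem_Lam hτ (by simpa using neg_mem_Lam h)
  have h := wzeta_add_one_sub_eq hτ hz hh
  rw [show (-(1 / 2) + 1 : ℂ) = 1 / 2 by norm_num, wzeta_neg] at h
  rw [eta1]
  linear_combination h

lemma tendsto_im_sub_intCast_mul_atBot {τ : ℂ} (hτ : 0 < τ.im) (z : ℂ) :
    Tendsto (fun n : ℤ ↦ (z - n * τ).im) atBot atTop := by
  have h : (fun n : ℤ ↦ (z - n * τ).im) = fun n : ℤ ↦ z.im + (-n : ℝ) * τ.im := by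
    ext n
    simp [sub_eq_add_neg]
  rw [h]
  refine tendsto_atTop_add_const_left _ _ (Tendsto.atTop_mul_const hτ ?_)
  exact tendsto_neg_atBot_atTop.comp (tendsto_intCast_atBot_iff.mpr tendsto_id)

lemma tendsto_im_sub_intCast_mul_atTop {τ : ℂ} (hτ : 0 < τ.im) (z : ℂ) :
    Tendsto (fun n : ℤ ↦ (z - n * τ).im) atTop atBot := by
  have h : (fun n : ℤ ↦ (z - n * τ).im) = fun n : ℤ ↦ z.im + (-n : ℝ) * τ.im := by
    ext n
    simp [sub_eq_add_neg]
  rw [h]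
  refine tendsto_atBot_add_const_left _ _ (Tendsto.atBot_mul_const hτ ?_)
  exact tendsto_neg_atTop_atBot.comp tendsto_intCast_atTop_atTop

lemma wzeta_add_tau_sub_eq {τ z : ℂ} (hτ : 0 < τ.im) (hz : z ∉ Lam τ) :
    wzeta τ (z + τ) - wzeta τ z - τ * (wzeta τ (z + 1) - wzeta τ z) = -(2 * Real.pi * I) := by
  have hSτ := (summable_zetaTerm hτ (z + τ)).sub (summable_zetaTerm hτ z)
  have hS1 := ((summable_zetaTerm hτ (z + 1)).sub (summable_zetaTerm hτ z))
  have hS := hSτ.sub (hS1.mul_left τ)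
  have hz1 := (add_mem_Lam_iff (one_mem_Lam τ)).not.mpr hz
  have hzτ := (add_mem_Lam_iff (tau_mem_Lam τ)).not.mpr hz
  simp only [wzeta_eq_tsum hτ]
  rw [← (summable_zetaTerm hτ (z + τ)).tsum_sub (summable_zetaTerm hτ z),
    ← (summable_zetaTerm hτ (z + 1)).tsum_sub (summable_zetaTerm hτ z), ← tsum_mul_left,
    ← hSτ.tsum_sub (hS1.mul_left τ), tsum_int_prod_comm hS]
  set f : ℤ → ℂ := fun n ↦ Real.pi * Complex.cot (Real.pi * (z + τ - n * τ)) with hf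
  have hinner (n : ℤ) : ∑' m, (zetaTerm (latPt τ (m, n)) (z + τ) - zetaTerm (latPt τ (m, n)) z -
      τ * (zetaTerm (latPt τ (m, n)) (z + 1) - zetaTerm (latPt τ (m, n)) z)) =
      f n - f (n + 1) := by
    refine tsum_eq_of_tendsto_sum_Icc (summable_fst_section hS n) ?_
    have h := ((tendsto_sum_Icc_latPt hzτ n).sub (tendsto_sum_Icc_latPt hz n)).sub
      (((tendsto_sum_Icc_latPt hz1 n).sub (tendsto_sum_Icc_latPt hz n)).const_mul τ)
    rw [add_sub_right_comm z 1, cot_pi_mul_add_one, sub_self, mul_zero, sub_zero] at h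
    have hfn : f (n + 1) = Real.pi * Complex.cot (Real.pi * (z - n * τ)) := by
      simp only [hf]
      push_cast
      ring_nf
    rw [hfn]
    refine h.congr fun N ↦ ?_
    simp only [← Finset.sum_sub_distrib, Finset.mul_sum]
    refine Finset.sum_congr rfl fun m _ ↦ ?_
    simp only [zetaTerm]
    ring
  have hsum : Summable fun n ↦ f n - f (n + 1) :=
    (((Equiv.prodComm ℤ ℤ).summable_iff.mpr hS).prod).congr hinner
  rw [tsum_congr hinner, tsum_int_sub_of_tendsto hsum
    (tendsto_pi_mul_cot_of_im_atTop (tendsto_im_sub_intCast_mul_atBot hτ (z + τ)))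
    (tendsto_pi_mul_cot_of_im_atBot (tendsto_im_sub_intCast_mul_atTop hτ (z + τ)))]
  ring

lemma wzeta_add_tau_eq {τ z : ℂ} (hτ : 0 < τ.im) (hz : z ∉ Lam τ) :
    wzeta τ (z + τ) = wzeta τ z + (τ * eta1 τ - 2 * Real.pi * I) := by
  linear_combination wzeta_add_tau_sub_eq hτ hz + τ * wzeta_add_one hτ hz

lemma eta2_eq {τ : ℂ} (hτ : 0 < τ.im) : eta2 τ = τ * eta1 τ - 2 * Real.pi * I := by
  have hh : -(τ / 2) ∉ Lam τ := fun h ↦ half_tau_notMem_Lam hτ (by simpa using neg_mem_Lam h)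
  have h := wzeta_add_tau_eq hτ hh
  rw [show -(τ / 2) + τ = τ / 2 by ring, wzeta_neg] at h
  rw [eta2]
  linear_combination h

lemma wzeta_add_tau {τ z : ℂ} (hτ : 0 < τ.im) (hz : z ∉ Lam τ) :
    wzeta τ (z + τ) = wzeta τ z + eta2 τ := by
  rw [eta2_eq hτ, wzeta_add_tau_eq hτ hz]

/-! ### The sigma function -/

/-- The factor of the Weierstrass sigma function attached to `ω`. -/
def sigmaFactor (ω z : ℂ) : ℂ := (1 - z / ω) * Complex.exp (z / ω + z ^ 2 / (2 * ω ^ 2))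

lemma norm_one_sub_mul_exp_sub_one_le {u : ℂ} (hu : ‖u‖ ≤ 1 / 2) :
    ‖(1 - u) * Complex.exp (u + u ^ 2 / 2) - 1‖ ≤ 4 / 3 * ‖u‖ ^ 3 := by
  have hne : 1 - u ≠ 0 := by
    rintro h
    rw [← sub_eq_zero.mp h] at hu
    norm_num at hu
  have h := Complex.norm_log_sub_logTaylor_le 2 (z := -u) (by rw [norm_neg]; linarith)
  have hT : Complex.logTaylor (2 + 1) (-u) = -(u + u ^ 2 / 2) := by
    simp [Complex.logTaylor_succ, Complex.logTaylor_zero]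
    ring
  rw [hT, norm_neg, sub_neg_eq_add, ← sub_eq_add_neg] at h
  have hinv : (1 - ‖u‖)⁻¹ ≤ 2 := by
    rw [inv_le_comm₀ (by linarith) two_pos]
    linarith
  have h1 : ‖Complex.log (1 - u) + (u + u ^ 2 / 2)‖ ≤ 2 / 3 * ‖u‖ ^ 3 := by
    refine h.trans ?_
    calc ‖u‖ ^ (2 + 1) * (1 - ‖u‖)⁻¹ / ((2 : ℕ) + 1) ≤ ‖u‖ ^ (2 + 1) * 2 / ((2 : ℕ) + 1) := by gcongr
      _ = 2 / 3 * ‖u‖ ^ 3 := by norm_num; ring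
  have h2 : ‖u‖ ^ 3 ≤ (1 / 2) ^ 3 := by gcongr
  have h3 := Complex.norm_exp_sub_one_le (x := Complex.log (1 - u) + (u + u ^ 2 / 2))
    (by linarith)
  rw [Complex.exp_add, Complex.exp_log hne] at h3
  linarith

lemma norm_sigmaFactor_sub_one_le {ω z : ℂ} (hω : ω ≠ 0) (h : 2 * ‖z‖ ≤ ‖ω‖) :
    ‖sigmaFactor ω z - 1‖ ≤ 4 / 3 * ‖z‖ ^ 3 * ‖ω‖ ^ (-3 : ℤ) := by
  have hpos : 0 < ‖ω‖ := norm_pos_iff.mpr hω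
  have hle : ‖z / ω‖ ≤ 1 / 2 := by
    rw [norm_div, div_le_iff₀ hpos]
    linarith
  have := norm_one_sub_mul_exp_sub_one_le hle
  rw [show (z / ω) ^ 2 / 2 = z ^ 2 / (2 * ω ^ 2) by field_simp] at this
  refine this.trans_eq ?_
  rw [norm_div, div_pow, div_eq_mul_inv (‖z‖ ^ 3), ← mul_assoc, zpow_neg,
    ← zpow_natCast ‖ω‖]
  rfl

lemma differentiable_sigmaFactor (ω : ℂ) : Differentiable ℂ (sigmaFactor ω) := by
  unfold sigmaFactor
  fun_prop

lemma sigmaFactor_ne_zero {ω z : ℂ} (hω : ω ≠ 0) (h : z ≠ ω) : sigmaFactor ω z ≠ 0 := by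
  refine mul_ne_zero (sub_ne_zero.mpr fun h1 ↦ h ?_) (Complex.exp_ne_zero _)
  rw [eq_comm, div_eq_one_iff_eq hω] at h1
  exact h1

lemma logDeriv_sigmaFactor {ω z : ℂ} (hω : ω ≠ 0) (h : z ≠ ω) :
    logDeriv (sigmaFactor ω) z = zetaTerm ω z := by
  have h0 : 1 - z / ω ≠ 0 := sub_ne_zero.mpr fun h1 ↦ h <| by
    rwa [eq_comm, div_eq_one_iff_eq hω] at h1
  have h1 : HasDerivAt (fun z ↦ 1 - z / ω) (-(1 / ω)) z :=
    ((hasDerivAt_id z).div_const ω).const_sub 1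
  have h2 : HasDerivAt (fun z ↦ z / ω + z ^ 2 / (2 * ω ^ 2)) (1 / ω + 2 * z / (2 * ω ^ 2)) z := by
    simpa using ((hasDerivAt_id z).div_const ω).fun_add ((hasDerivAt_pow 2 z).div_const (2 * ω ^ 2))
  have hd : HasDerivAt (sigmaFactor ω) _ z := h1.mul h2.cexp
  have hne : z - ω ≠ 0 := sub_ne_zero.mpr h
  have hne' : ω - z ≠ 0 := sub_ne_zero.mpr h.symm
  rw [logDeriv_apply, hd.deriv, sigmaFactor, zetaTerm,
    div_eq_iff (mul_ne_zero h0 (Complex.exp_ne_zero _))]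
  field_simp
  ring

lemma multipliableLocallyUniformlyOn_sigmaFactor {τ : ℂ} (hτ : 0 < τ.im) :
    MultipliableLocallyUniformlyOn (fun (ω : Lam' τ) z ↦ sigmaFactor ω z) Set.univ := by
  refine ⟨fun z ↦ ∏' ω : Lam' τ, (1 + (sigmaFactor ω z - 1)), ?_⟩
  have h : (fun (ω : Lam' τ) z ↦ sigmaFactor ω z) =
      fun (ω : Lam' τ) z ↦ 1 + (sigmaFactor ω z - 1) := by
    ext
    ring
  rw [h]
  refine hasProdLocallyUniformlyOn_of_forall_compact isOpen_univ fun K _ hK ↦ ?_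
  obtain ⟨R, hR⟩ := hK.isBounded.exists_norm_le
  refine Summable.hasProdUniformlyOn_one_add hK
    ((summable_norm_Lam' hτ).mul_left (4 / 3 * R ^ 3)) ?_
    fun ω ↦ ((differentiable_sigmaFactor ω).continuous.sub continuous_const).continuousOn
  filter_upwards [eventually_le_norm_Lam' hτ (2 * R)] with ω hω z hz
  have hzR := hR z hz
  refine (norm_sigmaFactor_sub_one_le ω.2.2 (by linarith)).trans ?_
  gcongr

lemma tprod_sigmaFactor_ne_zero {τ z : ℂ} (hτ : 0 < τ.im) (hz : z ∉ Lam τ) :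
    ∏' ω : Lam' τ, sigmaFactor ω z ≠ 0 := by
  have h := tprod_one_add_ne_zero_of_summable (f := fun ω : Lam' τ ↦ sigmaFactor ω z - 1)
    (fun ω ↦ by
      rw [add_sub_cancel]
      exact sigmaFactor_ne_zero ω.2.2 fun h ↦ hz (h ▸ ω.2.1))
    (.of_norm_bounded_eventually ((summable_norm_Lam' hτ).mul_left (4 / 3 * ‖z‖ ^ 3)) (by
      filter_upwards [eventually_le_norm_Lam' hτ (2 * ‖z‖)] with ω hω
      simpa using norm_sigmaFactor_sub_one_le ω.2.2 hω))
  simpa using h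

lemma wsigma_eq (τ : ℂ) : wsigma τ = fun z ↦ z * ∏' ω : Lam' τ, sigmaFactor ω z := rfl

lemma wsigma_ne_zero {τ z : ℂ} (hτ : 0 < τ.im) (hz : z ∉ Lam τ) : wsigma τ z ≠ 0 :=
  mul_ne_zero (fun h ↦ hz (h ▸ zero_mem_Lam τ)) (tprod_sigmaFactor_ne_zero hτ hz)

lemma differentiable_tprod_sigmaFactor {τ : ℂ} (hτ : 0 < τ.im) :
    Differentiable ℂ fun z ↦ ∏' ω : Lam' τ, sigmaFactor ω z := by
  rw [← differentiableOn_univ]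
  refine (multipliableLocallyUniformlyOn_sigmaFactor hτ).hasProdLocallyUniformlyOn.differentiableOn
    (.of_forall fun s ↦ ?_) isOpen_univ
  exact DifferentiableOn.fun_finsetProd fun ω _ ↦ (differentiable_sigmaFactor ω).differentiableOn

lemma differentiable_wsigma {τ : ℂ} (hτ : 0 < τ.im) : Differentiable ℂ (wsigma τ) :=
  differentiable_id.mul (differentiable_tprod_sigmaFactor hτ)

lemma logDeriv_wsigma {τ z : ℂ} (hτ : 0 < τ.im) (hz : z ∉ Lam τ) :
    logDeriv (wsigma τ) z = wzeta τ z := by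
  have hz0 : z ≠ 0 := fun h ↦ hz (h ▸ zero_mem_Lam τ)
  have hzω (ω : Lam' τ) : z ≠ ω := fun h ↦ hz (h ▸ ω.2.1)
  have hlog (ω : Lam' τ) : logDeriv (fun z ↦ sigmaFactor ω z) z = zetaTerm ω z :=
    logDeriv_sigmaFactor ω.2.2 (hzω ω)
  rw [wsigma_eq, logDeriv_mul z hz0 (tprod_sigmaFactor_ne_zero hτ hz) differentiableAt_fun_id
    (differentiable_tprod_sigmaFactor hτ z), logDeriv_id',
    logDeriv_tprod_eq_tsum isOpen_univ (Set.mem_univ z)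
      (fun ω : Lam' τ ↦ sigmaFactor_ne_zero ω.2.2 (hzω ω))
      (fun ω ↦ (differentiable_sigmaFactor ω).differentiableOn)
      ((summable_zetaTerm_Lam' hτ z).congr fun ω ↦ (hlog ω).symm)
      (multipliableLocallyUniformlyOn_sigmaFactor hτ) (tprod_sigmaFactor_ne_zero hτ hz),
    tsum_congr hlog]
  rfl

lemma hasDerivAt_wsigma {τ z : ℂ} (hτ : 0 < τ.im) (hz : z ∉ Lam τ) :
    HasDerivAt (wsigma τ) (wzeta τ z * wsigma τ z) z := by
  have h := (differentiable_wsigma hτ z).hasDerivAt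
  rwa [← logDeriv_wsigma hτ hz, logDeriv_apply, div_mul_cancel₀ _ (wsigma_ne_zero hτ hz)]

lemma wsigma_add_of_wzeta_add {τ ω η z : ℂ} (hτ : 0 < τ.im) (hω : ω ∈ Lam τ) (hω2 : ω / 2 ∉ Lam τ)
    (hζ : ∀ z ∉ Lam τ, wzeta τ (z + ω) = wzeta τ z + η) (hz : z ∉ Lam τ) :
    wsigma τ (z + ω) = -Complex.exp (η * (z + ω / 2)) * wsigma τ z := by
  let q : ℂ → ℂ := fun z ↦ wsigma τ (z + ω) * Complex.exp (-(η * (z + ω / 2))) / wsigma τ z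
  have hq (z : ℂ) (hz : z ∉ Lam τ) : HasDerivAt q 0 z := by
    have h1 := (hasDerivAt_wsigma hτ ((add_mem_Lam_iff hω).not.mpr hz)).comp_add_const z ω
    have h2 : HasDerivAt (fun z ↦ -(η * (z + ω / 2))) (-η) z := by
      simpa using (((hasDerivAt_id z).add_const (ω / 2)).const_mul η).fun_neg
    have h3 := (h1.mul h2.cexp).div (hasDerivAt_wsigma hτ hz) (wsigma_ne_zero hτ hz)
    refine h3.congr_deriv ?_
    rw [hζ z hz, Pi.mul_apply]
    ring
  have hc : -(ω / 2) ∉ Lam τ := fun h ↦ hω2 (by simpa using neg_mem_Lam h)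
  have heq : q z = q (-(ω / 2)) :=
    (isClosed_Lam hτ).isOpen_compl.is_const_of_deriv_eq_zero (isPreconnected_compl_Lam τ)
      (fun x hx ↦ (hq x hx).differentiableAt.differentiableWithinAt) (fun x hx ↦ (hq x hx).deriv)
      hz hc
  have hval : q (-(ω / 2)) = -1 := by
    simp only [q]
    rw [show -(ω / 2) + ω = ω / 2 by ring, wsigma_neg, neg_add_cancel, mul_zero, neg_zero,
      Complex.exp_zero, mul_one, div_neg, div_self (wsigma_ne_zero hτ hω2)]
  rw [hval, div_eq_iff (wsigma_ne_zero hτ hz), Complex.exp_neg,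
    mul_inv_eq_iff_eq_mul₀ (Complex.exp_ne_zero _)] at heq
  rw [heq]
  ring

lemma wsigma_add_one {τ z : ℂ} (hτ : 0 < τ.im) (hz : z ∉ Lam τ) :
    wsigma τ (z + 1) = -Complex.exp (eta1 τ * (z + 1 / 2)) * wsigma τ z :=
  wsigma_add_of_wzeta_add hτ (one_mem_Lam τ) (half_notMem_Lam hτ)
    (fun _ hx ↦ wzeta_add_one hτ hx) hz

lemma wsigma_add_tau {τ z : ℂ} (hτ : 0 < τ.im) (hz : z ∉ Lam τ) :
    wsigma τ (z + τ) = -Complex.exp (eta2 τ * (z + τ / 2)) * wsigma τ z :=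
  wsigma_add_of_wzeta_add hτ (tau_mem_Lam τ) (half_tau_notMem_Lam hτ)
    (fun _ hx ↦ wzeta_add_tau hτ hx) hz

/-! ### The developing map -/

lemma hdev_add_of_wsigma_add {τ a ω η z : ℂ}
    (hσ : ∀ z ∉ Lam τ, wsigma τ (z + ω) = -Complex.exp (η * (z + ω / 2)) * wsigma τ z)
    (hm : z - a ∉ Lam τ) (hp : z + a ∉ Lam τ) :
    hdev τ a (z + ω) = Complex.exp (2 * wzeta τ a * ω - 2 * η * a) * hdev τ a z := by
  have he : Complex.exp (η * (z - a + ω / 2)) =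
      Complex.exp (-(2 * η * a)) * Complex.exp (η * (z + a + ω / 2)) := by
    rw [← Complex.exp_add]
    ring_nf
  rw [hdev, hdev, show z + ω - a = z - a + ω by ring, show z + ω + a = z + a + ω by ring,
    hσ _ hm, hσ _ hp, he, mul_add, Complex.exp_add,
    sub_eq_add_neg (2 * wzeta τ a * ω), Complex.exp_add]
  have hne := Complex.exp_ne_zero (η * (z + a + ω / 2))
  field_simp
/-- if `a = r + sτ` is a critical point of the Green function
(`ζ(a) = rη₁ + sη₂`), then `h` is a type II developing map with monodromy data
`(r, s)`, and consequently `f = h²` is one with monodromy data `(2r, 2s)`. -/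
theorem stmt_14 (τ r s : ℂ) (hτ : 0 < τ.im)
    (h2a : 2 * (r + s * τ) ∉ Lam τ)
    (hZ : wzeta τ (r + s * τ) = r * eta1 τ + s * eta2 τ) :
    ∀ z : ℂ, z - (r + s * τ) ∉ Lam τ → z + (r + s * τ) ∉ Lam τ →
      (hdev τ (r + s * τ) (z + 1)
          = Complex.exp (-(4 * Real.pi * Complex.I) * s) * hdev τ (r + s * τ) z ∧
        hdev τ (r + s * τ) (z + τ)
          = Complex.exp (4 * Real.pi * Complex.I * r) * hdev τ (r + s * τ) z) ∧
      ((hdev τ (r + s * τ) (z + 1)) ^ 2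
          = Complex.exp (-(4 * Real.pi * Complex.I) * (2 * s)) * (hdev τ (r + s * τ) z) ^ 2 ∧
        (hdev τ (r + s * τ) (z + τ)) ^ 2
          = Complex.exp (4 * Real.pi * Complex.I * (2 * r)) * (hdev τ (r + s * τ) z) ^ 2) := by

  intro z hm hp
  have h1 : hdev τ (r + s * τ) (z + 1) =
      Complex.exp (-(4 * Real.pi * Complex.I) * s) * hdev τ (r + s * τ) z := by
    rw [hdev_add_of_wsigma_add (fun _ hx ↦ wsigma_add_one hτ hx) hm hp, hZ, eta2_eq hτ]
    ring_nf
  have h2 : hdev τ (r + s * τ) (z + τ) =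
      Complex.exp (4 * Real.pi * Complex.I * r) * hdev τ (r + s * τ) z := by
    rw [hdev_add_of_wsigma_add (fun _ hx ↦ wsigma_add_tau hτ hx) hm hp, hZ, eta2_eq hτ]
    ring_nf
  refine ⟨⟨h1, h2⟩, ?_, ?_⟩
  · rw [h1, mul_pow, ← Complex.exp_nat_mul]
    push_cast
    ring_nf
  · rw [h2, mul_pow, ← Complex.exp_nat_mul]
    push_cast
    ring_nf
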